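/- arXiv:2010.05833 — 2 statements merged into one kernel-verified Lean document; each statement's English description precedes it below -/
import Mathlib

section
/- Let $G$ be a finite connected graph with $n$ vertices, and let $L(G) = D(G) - A(G)$ be its Laplacian matrix. Let $\phi(G,e)$ denote the number of spanning forests of $G$ with exactly $e$ edges, and for such a forest $F$ with connected components of sizes $m_1, \ldots, m_k$, let $\rho(F) = m_1 \cdots m_k$ (the number of ways to root $F$ by choosing one root per component). Then the coefficient $c_e$ of $t^{n-e}$ in the characteristic polynomial of $L(G)$ satisfies $(-1)^e c_e = \sum_F \rho(F)$, where the sum runs over all spanning forests $F$ of $G$ with $e$ edges. -/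
open scoped Classical

/-- The number of ways of rooting the spanning forest with edge set `F`: the number of
choices of one vertex in each connected component, i.e. `ρ(F) = m₁ ⋯ m_k`. -/
noncomputable def forestRootings {V : Type*} [Fintype V] (F : Set (Sym2 V)) : ℕ :=
  Nat.card {f : (SimpleGraph.fromEdgeSet F).ConnectedComponent → V //
    ∀ c, (SimpleGraph.fromEdgeSet F).connectedComponentMk (f c) = c}

/-- Gram matrix of a finite subfamily. -/
noncomputable def gramOn {ι V : Type*} [Fintype V] (b : ι → V → ℚ) (F : Finset ι) :
    Matrix F F ℚ :=
  Matrix.of fun e f => b e.1 ⬝ᵥ b f.1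

theorem gramOn_insert {ι V : Type*} [Fintype V] [DecidableEq ι] (b : ι → V → ℚ) (F : Finset ι)
    (f : ι) (hf : f ∉ F) (p : V → ℚ) (hp : ∀ e ∈ F, b e ⬝ᵥ p = 0)
    (hs : b f - p ∈ Submodule.span ℚ (Set.range fun e : F => b e.1)) :
    (gramOn b (insert f F)).det = (gramOn b F).det * (p ⬝ᵥ p) := by
  obtain ⟨w, hw⟩ := (Submodule.mem_span_range_iff_exists_fun ℚ).1 hs
  have hbf : b f = (∑ e : F, w e • b e.1) + p := by rw [hw]; simp
  let E : F ⊕ PUnit.{1} ≃ (insert f F : Finset ι) :=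
    ((Finset.subtypeInsertEquivOption hf).trans (Equiv.optionEquivSumPUnit _)).symm
  have hEl : ∀ e : F, (E (Sum.inl e)).1 = e.1 := fun e => by
    simp [E, Finset.subtypeInsertEquivOption]
  have hEr : ∀ u, (E (Sum.inr u)).1 = f := fun u => by
    simp [E, Finset.subtypeInsertEquivOption]
  rw [← Matrix.det_submatrix_equiv_self E]
  have key : (gramOn b (insert f F)).submatrix E E =
      Matrix.fromBlocks 1 0 (Matrix.of fun _ e => w e) 1 *
      Matrix.fromBlocks (gramOn b F) 0 0 (Matrix.of fun (_ _ : PUnit.{1}) => p ⬝ᵥ p) *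
      Matrix.fromBlocks 1 (Matrix.of fun e _ => w e) 0 1 := by
    have hpf : ∀ e : F, b e.1 ⬝ᵥ b f = ∑ g : F, w g * (b e.1 ⬝ᵥ b g.1) := fun e => by
      rw [hbf, dotProduct_add, hp e.1 e.2, dotProduct_sum]
      simp
    have hpp : p ⬝ᵥ b f = p ⬝ᵥ p := by
      rw [hbf, dotProduct_add, dotProduct_sum]
      simp [dotProduct_comm p, hp]
    have hff : b f ⬝ᵥ b f = (∑ g : F, w g * (b g.1 ⬝ᵥ b f)) + p ⬝ᵥ p := by
      nth_rewrite 1 [hbf]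
      rw [add_dotProduct, hpp, sum_dotProduct]
      simp
    rw [Matrix.fromBlocks_multiply, Matrix.fromBlocks_multiply]
    ext i j
    rcases i with i | i <;> rcases j with j | j
    · simp [gramOn, hEl]
    · simp [gramOn, hEl, hEr, Matrix.mul_apply, hpf, mul_comm]
    · simp [gramOn, hEl, hEr, Matrix.mul_apply, dotProduct_comm (b f), hpf, dotProduct_comm (b j.1)]
    · simp [gramOn, hEr, Matrix.mul_apply, hff, hpf, Finset.mul_sum, Finset.sum_mul]
      rw [Finset.sum_comm]
      refine Finset.sum_congr rfl fun _ _ => Finset.sum_congr rfl fun _ _ => by ring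
  rw [key, Matrix.det_mul, Matrix.det_mul, Matrix.det_fromBlocks_zero₁₂,
    Matrix.det_fromBlocks_zero₁₂, Matrix.det_fromBlocks_zero₂₁]
  simp

/-- size of a component -/
noncomputable def csize {V : Type*} {H : SimpleGraph V} (c : H.ConnectedComponent) : ℕ :=
  Nat.card {x : V // H.connectedComponentMk x = c}

theorem csize_pos {V : Type*} [Finite V] {H : SimpleGraph V} (c : H.ConnectedComponent) :
    0 < csize c := by
  have : Nonempty {x : V // H.connectedComponentMk x = c} := by
    obtain ⟨x, hx⟩ := c.exists_rep
    exact ⟨⟨x, hx⟩⟩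
  exact Nat.card_pos

/-- product of the component sizes -/
noncomputable def rootCount {V : Type*} [Fintype V] (H : SimpleGraph V) : ℕ :=
  ∏ c : H.ConnectedComponent, csize c

theorem card_rootings {V : Type*} [Fintype V] (H : SimpleGraph V) :
    Nat.card {f : H.ConnectedComponent → V // ∀ c, H.connectedComponentMk (f c) = c} =
      rootCount H := by
  unfold rootCount csize
  rw [← Nat.card_pi]
  exact Nat.card_congr (Equiv.subtypePiEquivPi
    (p := fun c x => H.connectedComponentMk x = c))

theorem forestRootings_eq {V : Type*} [Fintype V] (F : Set (Sym2 V)) :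
    forestRootings F = rootCount (SimpleGraph.fromEdgeSet F) :=
  card_rootings _

theorem prod_csize_sup_edge {V : Type*} [Fintype V] (H H' : SimpleGraph V) (u v : V)
    (hH' : H' = H ⊔ SimpleGraph.edge u v) (huv : ¬ H.Reachable u v) :
    rootCount H' *
      (csize (H.connectedComponentMk u) * csize (H.connectedComponentMk v)) =
    rootCount H *
      (csize (H.connectedComponentMk u) + csize (H.connectedComponentMk v)) := by
  have hle : H ≤ H' := by rw [hH']; exact le_sup_left
  have hne : u ≠ v := fun h => huv (h ▸ SimpleGraph.Reachable.refl _)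
  have hadj : H'.Adj u v := by
    rw [hH']; simp [SimpleGraph.edge_adj, hne]
  let A := H.connectedComponentMk u
  let B := H.connectedComponentMk v
  have hAB : A ≠ B := fun h => huv (SimpleGraph.ConnectedComponent.eq.1 h)
  let φ : H.ConnectedComponent → H'.ConnectedComponent :=
    fun c => c.map (SimpleGraph.Hom.ofLE hle)
  have hφmk : ∀ x, φ (H.connectedComponentMk x) = H'.connectedComponentMk x := fun x => rfl
  have hφAB : φ B = φ A := by
    rw [hφmk, hφmk]
    exact SimpleGraph.ConnectedComponent.eq.2 hadj.reachable.symm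
  let g : H.ConnectedComponent → H.ConnectedComponent := fun c => if c = B then A else c
  have hg : ∀ x y, H'.Reachable x y →
      g (H.connectedComponentMk x) = g (H.connectedComponentMk y) := by
    rintro x y ⟨w⟩
    induction w with
    | nil => rfl
    | @cons a b c hab w ih =>
      rw [← ih]
      rw [hH', SimpleGraph.sup_adj, SimpleGraph.edge_adj] at hab
      rcases hab with h | ⟨⟨rfl, rfl⟩ | ⟨rfl, rfl⟩, _⟩
      · rw [SimpleGraph.ConnectedComponent.eq.2 h.reachable]
      · simp [g, A, B]
      · simp [g, A, B]
  have hφg : ∀ c d, φ c = φ d → g c = g d := by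
    intro c d
    induction c using SimpleGraph.ConnectedComponent.ind with | _ x
    induction d using SimpleGraph.ConnectedComponent.ind with | _ y
    intro h
    exact hg x y (SimpleGraph.ConnectedComponent.eq.1 h)
  have hsurj : Function.Surjective φ := by
    intro c
    induction c using SimpleGraph.ConnectedComponent.ind with | _ x
    exact ⟨H.connectedComponentMk x, rfl⟩
  have hsize : ∀ c', csize c' = ∑ c with φ c = c', csize c := by
    intro c'
    unfold csize
    simp_rw [Nat.card_eq_fintype_card, Fintype.card_subtype]
    rw [Finset.card_eq_sum_card_fiberwise (f := H.connectedComponentMk)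
      (t := Finset.univ.filter fun c => φ c = c')]
    · refine Finset.sum_congr rfl fun c hc => ?_
      congr 1
      ext x
      simp only [Finset.mem_filter, Finset.mem_univ, true_and, and_iff_right_iff_imp] at hc ⊢
      rintro rfl
      exact hc
    · intro x hx
      simpa [hφmk] using hx
  have hfA : (Finset.univ.filter fun c => φ c = φ A) = {A, B} := by
    ext c
    simp only [Finset.mem_filter, Finset.mem_univ, true_and, Finset.mem_insert,
      Finset.mem_singleton]
    constructor
    · intro h
      have := hφg _ _ h
      simp only [g] at this
      split_ifs at this <;> simp_all
    · rintro (rfl | rfl)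
      · rfl
      · exact hφAB
  have hfo : ∀ c' ≠ φ A, ∃ c, (Finset.univ.filter fun c => φ c = c') = {c} := by
    intro c' hc'
    obtain ⟨c, rfl⟩ := hsurj c'
    refine ⟨c, ?_⟩
    ext d
    simp only [Finset.mem_filter, Finset.mem_univ, true_and, Finset.mem_singleton]
    constructor
    · intro h
      have h2 := hφg _ _ h
      have h3 : c ≠ B := fun hh => hc' (by rw [hh, hφAB])
      have h4 : d ≠ B := fun hh => hc' (by rw [← h, hh, hφAB])
      simpa [g, h3, h4] using h2
    · rintro rfl; rfl
  unfold rootCount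
  rw [← Finset.prod_fiberwise Finset.univ φ (fun c => csize c)]
  rw [← Finset.mul_prod_erase Finset.univ _ (Finset.mem_univ (φ A)),
    ← Finset.mul_prod_erase Finset.univ (fun c' => ∏ c with φ c = c', csize c)
      (Finset.mem_univ (φ A))]
  rw [hsize (φ A), hfA, Finset.sum_pair hAB, Finset.prod_pair hAB]
  have : ∏ x ∈ Finset.univ.erase (φ A), csize x =
      ∏ x ∈ Finset.univ.erase (φ A), ∏ c with φ c = x, csize c := by
    refine Finset.prod_congr rfl fun c' hc' => ?_
    obtain ⟨c, hc⟩ := hfo c' (Finset.ne_of_mem_erase hc')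
    rw [hsize, hc]; simp
  rw [this]
  ring

/-- indicator vector -/
noncomputable def dvec {V : Type*} (x : V) : V → ℚ := fun i => if x = i then 1 else 0

/-- oriented incidence vector of an edge -/
noncomputable def bvec {V : Type*} (e : Sym2 V) : V → ℚ :=
  dvec (Quot.out e).1 - dvec (Quot.out e).2

theorem bvec_mk {V : Type*} (x y : V) :
    bvec s(x, y) = dvec x - dvec y ∨ bvec s(x, y) = dvec y - dvec x := by
  have h : s((Quot.out s(x, y)).1, (Quot.out s(x, y)).2) = s(x, y) := Quot.out_eq s(x, y)
  unfold bvec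
  rcases Sym2.eq_iff.1 h with ⟨h1, h2⟩ | ⟨h1, h2⟩
  · left; rw [h1, h2]
  · right; rw [h1, h2]

/-- normalized indicator of a component -/
noncomputable def avec {V : Type*} {H : SimpleGraph V} (c : H.ConnectedComponent) : V → ℚ :=
  fun i => if H.connectedComponentMk i = c then (csize c : ℚ)⁻¹ else 0

theorem dvec_dot {V : Type*} [Fintype V] (x : V) (p : V → ℚ) : dvec x ⬝ᵥ p = p x := by
  simp [dvec, dotProduct]

theorem dvec_sub_mem {V : Type*} (F : Finset (Sym2 V)) (x y : V)
    (h : (SimpleGraph.fromEdgeSet (↑F : Set (Sym2 V))).Reachable x y) :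
    dvec x - dvec y ∈ Submodule.span ℚ (Set.range fun e : F => bvec e.1) := by
  obtain ⟨w⟩ := h
  induction w with
  | nil => simp
  | @cons a b c hab w ih =>
    have h1 : dvec a - dvec b ∈ Submodule.span ℚ (Set.range fun e : F => bvec e.1) := by
      have hm : bvec s(a, b) ∈ Submodule.span ℚ (Set.range fun e : F => bvec e.1) :=
        Submodule.subset_span ⟨⟨s(a, b), by simpa using hab.1⟩, rfl⟩
      rcases bvec_mk a b with h | h
      · rwa [h] at hm
      · rw [← neg_sub, ← h]; exact Submodule.neg_mem _ hm
    have := Submodule.add_mem _ h1 ih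
    simpa using this

theorem csize_eq_sum {V : Type*} [Fintype V] {H : SimpleGraph V} (c : H.ConnectedComponent) :
    (csize c : ℚ) = ∑ x, if H.connectedComponentMk x = c then 1 else 0 := by
  unfold csize
  rw [Nat.card_eq_fintype_card, Fintype.card_subtype]
  simp

theorem dvec_sub_avec_mem {V : Type*} [Fintype V] (F : Finset (Sym2 V)) (x : V) :
    dvec x - avec ((SimpleGraph.fromEdgeSet (↑F : Set (Sym2 V))).connectedComponentMk x) ∈
      Submodule.span ℚ (Set.range fun e : F => bvec e.1) := by
  set H := SimpleGraph.fromEdgeSet (↑F : Set (Sym2 V)) with hH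
  have hc : (csize (H.connectedComponentMk x) : ℚ) ≠ 0 := by
    exact_mod_cast (csize_pos _).ne'
  have key : dvec x - avec (H.connectedComponentMk x) =
      (csize (H.connectedComponentMk x) : ℚ)⁻¹ •
        ∑ y with H.connectedComponentMk y = H.connectedComponentMk x, (dvec x - dvec y) := by
    ext i
    have hcard := csize_eq_sum (H.connectedComponentMk x)
    rw [Finset.sum_boole] at hcard
    simp only [Pi.sub_apply, Pi.smul_apply, Finset.sum_apply, Finset.sum_sub_distrib,
      Finset.sum_const, smul_eq_mul, nsmul_eq_mul, Pi.mul_apply, Pi.natCast_apply]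
    rw [← hcard, mul_sub, ← mul_assoc, inv_mul_cancel₀ hc, one_mul]
    congr 1
    simp [avec, dvec, Finset.sum_ite_eq']
  rw [key]
  refine Submodule.smul_mem _ _ (Submodule.sum_mem _ fun y hy => dvec_sub_mem F x y ?_)
  simp only [Finset.mem_filter, Finset.mem_univ, true_and] at hy
  exact SimpleGraph.ConnectedComponent.eq.1 hy.symm

theorem avec_dot_self {V : Type*} [Fintype V] {H : SimpleGraph V} (c : H.ConnectedComponent) :
    avec c ⬝ᵥ avec c = (csize c : ℚ)⁻¹ := by
  have hc : (csize c : ℚ) ≠ 0 := by exact_mod_cast (csize_pos _).ne'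
  have : avec c ⬝ᵥ avec c = (∑ x, if H.connectedComponentMk x = c then (1 : ℚ) else 0) *
      ((csize c : ℚ)⁻¹ * (csize c : ℚ)⁻¹) := by
    rw [Finset.sum_mul]
    refine Finset.sum_congr rfl fun x _ => ?_
    simp only [avec]
    split_ifs <;> simp
  rw [this, ← csize_eq_sum]
  field_simp

theorem avec_dot_ne {V : Type*} [Fintype V] {H : SimpleGraph V} (c d : H.ConnectedComponent)
    (h : c ≠ d) : avec c ⬝ᵥ avec d = 0 := by
  refine Finset.sum_eq_zero fun x _ => ?_
  simp only [avec]
  split_ifs with h1 h2 <;> simp_all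

theorem bvec_dot_avec {V : Type*} [Fintype V] (F : Finset (Sym2 V)) (e : Sym2 V) (he : e ∈ F)
    (c : (SimpleGraph.fromEdgeSet (↑F : Set (Sym2 V))).ConnectedComponent) :
    bvec e ⬝ᵥ avec c = 0 := by
  induction e using Sym2.ind with | _ x y
  have hxy : (SimpleGraph.fromEdgeSet (↑F : Set (Sym2 V))).connectedComponentMk x =
      (SimpleGraph.fromEdgeSet (↑F : Set (Sym2 V))).connectedComponentMk y := by
    by_cases hne : x = y
    · rw [hne]
    · refine SimpleGraph.ConnectedComponent.eq.2 (SimpleGraph.Adj.reachable ?_)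
      simp [he, hne]
  have : (avec c) x = (avec c) y := by simp only [avec, hxy]
  rcases bvec_mk x y with h | h <;> rw [h, sub_dotProduct, dvec_dot, dvec_dot, this, sub_self]

theorem det_gramOn_bvec {V : Type*} [Fintype V] (F : Finset (Sym2 V))
    (hF : ∀ e ∈ F, ¬ e.IsDiag) :
    (gramOn bvec F).det =
      if (SimpleGraph.fromEdgeSet (↑F : Set (Sym2 V))).IsAcyclic then
        (forestRootings (↑F : Set (Sym2 V)) : ℚ) else 0 := by
  induction F using Finset.induction_on with
  | empty =>
    rw [forestRootings_eq]
    have h1 : (SimpleGraph.fromEdgeSet (↑(∅ : Finset (Sym2 V)) : Set (Sym2 V))) = ⊥ := by simp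
    rw [h1]
    have h2 : ∀ c : (⊥ : SimpleGraph V).ConnectedComponent, csize c = 1 := by
      intro c
      induction c using SimpleGraph.ConnectedComponent.ind with | _ x
      unfold csize
      simp [SimpleGraph.ConnectedComponent.eq, SimpleGraph.reachable_bot]
    simp [rootCount, h2]
  | insert f F hf ih0 =>
    have ih := ih0 fun e he => hF e (Finset.mem_insert_of_mem he)
    have hfd := hF f (Finset.mem_insert_self _ _)
    induction f using Sym2.ind with | _ u v
    clear ih0
    have huv : u ≠ v := by simpa using hfd
    have hH' : SimpleGraph.fromEdgeSet (↑(insert s(u, v) F) : Set (Sym2 V)) =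
        SimpleGraph.fromEdgeSet (↑F : Set (Sym2 V)) ⊔ SimpleGraph.edge u v := by
      rw [SimpleGraph.edge, ← SimpleGraph.fromEdgeSet_union]
      rw [Finset.coe_insert, Set.insert_eq, Set.union_comm]
    have hprod := prod_csize_sup_edge _ _ u v hH'
    have hac : (SimpleGraph.fromEdgeSet (↑(insert s(u, v) F) : Set (Sym2 V))).IsAcyclic ↔
        (SimpleGraph.fromEdgeSet (↑F : Set (Sym2 V))).IsAcyclic ∧
        ¬ (SimpleGraph.fromEdgeSet (↑F : Set (Sym2 V))).Reachable u v := by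
      rw [hH', SimpleGraph.isAcyclic_sup_fromEdgeSet_iff]
      simp [huv, hf]
    rw [forestRootings_eq] at ih ⊢
    set H := SimpleGraph.fromEdgeSet (↑F : Set (Sym2 V)) with hH
    set H' := SimpleGraph.fromEdgeSet (↑(insert s(u, v) F) : Set (Sym2 V)) with hH'def
    set A := H.connectedComponentMk u with hA
    set B := H.connectedComponentMk v with hB
    have hdet : (gramOn bvec (insert s(u, v) F)).det =
        (gramOn bvec F).det * ((avec A - avec B) ⬝ᵥ (avec A - avec B)) := by
      have hmem : (dvec u - dvec v) - (avec A - avec B) ∈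
          Submodule.span ℚ (Set.range fun e : F => bvec e.1) := by
        have := Submodule.sub_mem _ (dvec_sub_avec_mem F u) (dvec_sub_avec_mem F v)
        convert this using 1
        abel
      rcases bvec_mk u v with h | h
      · refine gramOn_insert bvec F _ hf _ (fun e he => ?_) (by rwa [h])
        rw [dotProduct_sub, bvec_dot_avec F e he, bvec_dot_avec F e he, sub_self]
      · rw [gramOn_insert bvec F _ hf (avec B - avec A) ?_ ?_]
        · rw [← neg_sub (avec A), neg_dotProduct_neg]
        · intro e he
          rw [dotProduct_sub, bvec_dot_avec F e he, bvec_dot_avec F e he, sub_self]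
        · rw [h]
          convert Submodule.neg_mem _ hmem using 1
          abel
    rw [hdet, ih]
    by_cases hr : H.Reachable u v
    · have hAB : A = B := SimpleGraph.ConnectedComponent.eq.2 hr
      rw [if_neg (fun h => (hac.1 h).2 hr), hAB]
      simp
    · have hAB : A ≠ B := fun h => hr (SimpleGraph.ConnectedComponent.eq.1 h)
      have hdot : (avec A - avec B) ⬝ᵥ (avec A - avec B) =
          (csize A : ℚ)⁻¹ + (csize B : ℚ)⁻¹ := by
        rw [sub_dotProduct, dotProduct_sub, dotProduct_sub, avec_dot_self, avec_dot_self,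
          avec_dot_ne _ _ hAB, avec_dot_ne _ _ hAB.symm]
        ring
      rw [hdot]
      by_cases hFac : H.IsAcyclic
      · rw [if_pos hFac, if_pos (hac.2 ⟨hFac, hr⟩)]
        have hp : (rootCount H' : ℚ) * (csize A * csize B) =
          (rootCount H : ℚ) * (csize A + csize B) := by
          exact_mod_cast hprod hr
        have ha : (csize A : ℚ) ≠ 0 := by exact_mod_cast (csize_pos _).ne'
        have hb : (csize B : ℚ) ≠ 0 := by exact_mod_cast (csize_pos _).ne'
        field_simp
        linear_combination -hp
      · rw [if_neg hFac, if_neg (fun h => hFac (hac.1 h).1), zero_mul]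

/-- incidence vectors of `G`, zero off the edge set -/
noncomputable def gvec {V : Type*} (G : SimpleGraph V) (e : Sym2 V) : V → ℚ :=
  if e ∈ G.edgeSet then bvec e else 0

theorem lap_eq {V : Type*} [Fintype V] [DecidableEq V] (G : SimpleGraph V) [DecidableRel G.Adj] :
    G.lapMatrix ℚ = (Matrix.of fun i e => gvec G e i) * (Matrix.of fun e i => gvec G e i) := by
  have hoff : ∀ i j, i ≠ j → ∀ e, gvec G e i * gvec G e j =
      if e = s(i, j) then (if G.Adj i j then -1 else 0) else 0 := by
    intro i j hij e
    induction e using Sym2.ind with | _ x y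
    unfold gvec
    simp only [SimpleGraph.mem_edgeSet]
    by_cases hxy : G.Adj x y
    · have hne := hxy.ne
      have hsymm := hxy.symm
      rw [if_pos hxy]
      simp only [Sym2.eq_iff]
      rcases bvec_mk x y with h | h <;> rw [h] <;> simp only [dvec, Pi.sub_apply] <;>
      grind
    · have hsymm : ¬ G.Adj y x := fun h => hxy h.symm
      rw [if_neg hxy]
      simp only [Sym2.eq_iff, Pi.zero_apply]
      grind
  have hdiag : ∀ i, ∀ e, gvec G e i * gvec G e i = G.incMatrix ℚ i e := by
    intro i e
    rw [SimpleGraph.incMatrix_apply']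
    induction e using Sym2.ind with | _ x y
    unfold gvec
    simp only [SimpleGraph.mem_edgeSet, SimpleGraph.incidenceSet, Set.mem_ofPred_eq, Sym2.mem_iff]
    by_cases hxy : G.Adj x y
    · have hne := hxy.ne
      rw [if_pos hxy]
      rcases bvec_mk x y with h | h <;> rw [h] <;> simp only [dvec, Pi.sub_apply] <;>
      grind
    · simp [hxy]
  ext i j
  rw [Matrix.mul_apply]
  simp only [Matrix.of_apply, SimpleGraph.lapMatrix, SimpleGraph.degMatrix, Matrix.sub_apply,
    SimpleGraph.adjMatrix_apply]
  by_cases hij : i = j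
  · subst hij
    simp_rw [hdiag]
    rw [SimpleGraph.sum_incMatrix_apply]
    simp
  · simp_rw [hoff i j hij]
    simp [hij]
    split_ifs <;> simp

theorem stmt1_rat {V : Type*} [Fintype V] [DecidableEq V] (G : SimpleGraph V)
    [DecidableRel G.Adj] (e : ℕ) (he : e ≤ Fintype.card V) :
    (-1 : ℚ) ^ e * (Matrix.charpoly (G.lapMatrix ℚ)).coeff (Fintype.card V - e) =
      ∑ F ∈ Finset.univ.filter (fun F : Finset (Sym2 V) =>
          (↑F : Set (Sym2 V)) ⊆ G.edgeSet ∧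
          (SimpleGraph.fromEdgeSet (↑F : Set (Sym2 V))).IsAcyclic ∧ F.card = e),
        (forestRootings (↑F : Set (Sym2 V)) : ℚ) := by
  have hcard : Fintype.card V ≤ Fintype.card (Sym2 V) :=
    Fintype.card_le_of_injective (fun x => s(x, x)) fun x y h => by simpa using h
  have hcoeff : (Matrix.charpoly (G.lapMatrix ℚ)).coeff (Fintype.card V - e) =
      (Matrix.charpoly ((Matrix.of fun e i => gvec G e i) *
        (Matrix.of fun i e => gvec G e i))).coeff (Fintype.card (Sym2 V) - e) := by
    rw [lap_eq, Matrix.charpoly_mul_comm_of_le (n := V) _ _ hcard]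
    rw [show Fintype.card (Sym2 V) - e =
      (Fintype.card V - e) + (Fintype.card (Sym2 V) - Fintype.card V) by omega,
      Polynomial.coeff_X_pow_mul]
  rw [hcoeff, Matrix.charpoly_coeff_eq_sum_minors _ _ (he.trans hcard), ← mul_assoc, ← mul_pow]
  simp only [mul_neg, mul_one, neg_neg, one_pow, one_mul]
  have hpc : Finset.powersetCard e (Finset.univ : Finset (Sym2 V)) =
      Finset.univ.filter (fun F : Finset (Sym2 V) => F.card = e) := by
    ext F; simp [Finset.mem_powersetCard]
  rw [hpc, Finset.sum_filter, Finset.sum_filter]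
  refine Finset.sum_congr rfl fun F _ => ?_
  by_cases hFe : F.card = e
  swap
  · simp [hFe]
  rw [if_pos hFe]
  by_cases hFG : (↑F : Set (Sym2 V)) ⊆ G.edgeSet
  · have : ((Matrix.of fun e i => gvec G e i) * (Matrix.of fun i e => gvec G e i)).submatrix
        (Subtype.val : F → Sym2 V) (Subtype.val : F → Sym2 V) = gramOn bvec F := by
      ext a b
      simp [Matrix.mul_apply, gramOn, gvec, dotProduct, hFG a.2, hFG b.2]
    rw [this]
    have hd := det_gramOn_bvec F fun e he => G.not_isDiag_of_mem_edgeSet (hFG he)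
    simp only [hFG, hFe, true_and, and_true]
    convert hd
  · rw [if_neg fun h => hFG h.1]
    obtain ⟨f, hf, hfG⟩ := Set.not_subset.1 hFG
    refine Matrix.det_eq_zero_of_row_eq_zero ⟨f, hf⟩ fun j => ?_
    simp [Matrix.mul_apply, gvec, hfG]

/-- matrix-forest theorem.  For a finite connected graph `G` on `n`
vertices, the coefficient `c_e` of `t^(n-e)` in the characteristic polynomial of the
Laplacian satisfies `(-1)^e c_e = ∑_F ρ(F)`, the sum over all spanning forests `F` of `G`
with exactly `e` edges of the number of their rootings. -/
theorem stmt1 {V : Type*} [Fintype V] [DecidableEq V] (G : SimpleGraph V)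
    [DecidableRel G.Adj] (hG : G.Connected) (e : ℕ) (he : e ≤ Fintype.card V) :
    (-1 : ℤ) ^ e * (Matrix.charpoly (G.lapMatrix ℤ)).coeff (Fintype.card V - e) =
      ∑ F ∈ Finset.univ.filter (fun F : Finset (Sym2 V) =>
          (↑F : Set (Sym2 V)) ⊆ G.edgeSet ∧
          (SimpleGraph.fromEdgeSet (↑F : Set (Sym2 V))).IsAcyclic ∧ F.card = e),
        (forestRootings (↑F : Set (Sym2 V)) : ℤ) := by
  have h := stmt1_rat G e he
  have hmap : G.lapMatrix ℚ = (G.lapMatrix ℤ).map (Int.castRingHom ℚ) := by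
    ext i j
    simp only [SimpleGraph.lapMatrix, SimpleGraph.degMatrix, Matrix.sub_apply, Matrix.map_apply,
      SimpleGraph.adjMatrix_apply, Matrix.diagonal_apply, eq_intCast]
    split_ifs <;> simp
  rw [hmap, Matrix.charpoly_map, Polynomial.coeff_map, eq_intCast] at h
  exact_mod_cast h
end

section
/- Let $C_{2n+1}$ be the cycle graph on $2n+1$ vertices, and let $r(G)$ denote the total number of rooted spanning forests of a graph $G$ (spanning forests with a choice of root in each component, isolated vertices allowed). Then $r(C_{2n+1}) = \Phi_{4n+1} + \Phi_{4n+3} - 2$, where $\Phi_i$ denotes the $i$-th Fibonacci number (with $\Phi_1 = \Phi_2 = 1$). -/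
/-- The number of rooted spanning forests of `G`: pairs of a spanning acyclic subgraph
(given by its edge set, isolated vertices allowed) together with a choice of one root in
each connected component. -/
noncomputable def rootedSpanningForestCard {V : Type*} [Fintype V] (G : SimpleGraph V) : ℕ :=
  Nat.card (Σ F : {F : Set (Sym2 V) // F ⊆ G.edgeSet ∧
      (SimpleGraph.fromEdgeSet F).IsAcyclic},
    {f : (SimpleGraph.fromEdgeSet F.1).ConnectedComponent → V //
      ∀ c, (SimpleGraph.fromEdgeSet F.1).connectedComponentMk (f c) = c})

open Relation in
/-- Step along an edge of `F` in the positive direction. -/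
def cycStep {N : ℕ} (F : Set (Sym2 (Fin (N+3)))) (a b : Fin (N+3)) : Prop :=
  b = a + 1 ∧ s(a, a+1) ∈ F

theorem cyc_ind {N : ℕ} (P : Fin (N+3) → Prop) (i : Fin (N+3)) (h0 : P i)
    (hs : ∀ x, P x → P (x+1)) (x : Fin (N+3)) : P x := by
  have key : ∀ y : Fin (N+3), P (i + y) := by
    intro y
    induction y using Fin.induction with
    | zero => simpa using h0
    | succ k ih =>
      have := hs _ ih
      rw [add_assoc, Fin.coeSucc_eq_succ] at this
      exact this
  have := key (x - i)
  simpa using this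

theorem cyc_ind' {N : ℕ} (P : Fin (N+3) → Prop) (i : Fin (N+3)) (h0 : P i)
    (hs : ∀ x, P (x+1) → P x) (x : Fin (N+3)) : P x := by
  have := cyc_ind (fun y => P (-y)) (-i) (by simpa using h0)
    (by intro y hy; apply hs; simpa using hy) (-x)
  simpa using this

theorem one_one_ne {N : ℕ} : (1 : Fin (N+3)) + 1 ≠ 0 := by
  intro h
  have := congrArg Fin.val h
  rw [Fin.val_add] at this
  have h2 : ((1 : Fin (N+3)).val + (1 : Fin (N+3)).val) = 2 := by simp
  rw [h2, Nat.mod_eq_of_lt (by omega)] at this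
  simp at this

theorem one_ne {N : ℕ} : (1 : Fin (N+3)) ≠ 0 := by simp

theorem edge_eq {N : ℕ} {a i : Fin (N+3)} : s(a, a+1) = s(i, i+1) ↔ a = i := by
  constructor
  · intro h
    rcases Sym2.eq_iff.1 h with h | h
    · exact h.1
    · exfalso
      obtain ⟨h1, h2⟩ := h
      rw [h1, add_assoc] at h2
      exact one_one_ne (by simpa using h2)
  · rintro rfl; rfl

theorem cyc_edge {N : ℕ} {e : Sym2 (Fin (N+3))} :
    e ∈ (SimpleGraph.cycleGraph (N+3)).edgeSet ↔ ∃ i, e = s(i, i+1) := by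
  induction e with
  | h u v =>
    rw [SimpleGraph.mem_edgeSet, SimpleGraph.cycleGraph_adj]
    constructor
    · rintro (h | h)
      · exact ⟨v, by rw [Sym2.eq_swap, show u = v + 1 by rw [← h]; abel]⟩
      · exact ⟨u, by rw [show v = u + 1 by rw [← h]; abel]⟩
    · rintro ⟨i, h⟩
      rcases Sym2.eq_iff.1 h with ⟨rfl, rfl⟩ | ⟨rfl, rfl⟩
      · right; abel
      · left; abel

open Relation in
theorem reach_run {N : ℕ} {F : Set (Sym2 (Fin (N+3)))}
    (hF : F ⊆ (SimpleGraph.cycleGraph (N+3)).edgeSet) {i j : Fin (N+3)}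
    (h : (SimpleGraph.fromEdgeSet F).Reachable i j) :
    ReflTransGen (cycStep F) i j ∨ ReflTransGen (cycStep F) j i := by
  obtain ⟨w⟩ := h
  induction w with
  | nil => left; exact .refl
  | @cons u v w hadj p ih =>
    have hm := (SimpleGraph.fromEdgeSet_adj _).1 hadj |>.1
    obtain ⟨a, ha⟩ := cyc_edge.1 (hF hm)
    have haF : s(a, a+1) ∈ F := ha ▸ hm
    rcases Sym2.eq_iff.1 ha with ⟨rfl, rfl⟩ | ⟨rfl, rfl⟩
    · have st : cycStep F u (u+1) := ⟨rfl, haF⟩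
      rcases ih with ih | ih
      · left; exact .head st ih
      · rcases ReflTransGen.cases_tail ih with h | ⟨c, hc, hc'⟩
        · left; rw [← h]; exact .single st
        · right
          have : c = u := by
            have := hc'.1
            exact (add_right_cancel this).symm
          exact this ▸ hc
    · have st : cycStep F v (v+1) := ⟨rfl, haF⟩
      rcases ih with ih | ih
      · rcases ReflTransGen.cases_head ih with h | ⟨c, hc, hc'⟩
        · right; rw [← h]; exact .single st
        · left; rw [← hc.1]; exact hc'
      · right; exact .tail ih st

theorem step_adj {N : ℕ} {F : Set (Sym2 (Fin (N+3)))} {i j : Fin (N+3)} (h : cycStep F i j) :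
    (SimpleGraph.fromEdgeSet F).Adj i j := by
  obtain ⟨rfl, h⟩ := h
  exact (SimpleGraph.fromEdgeSet_adj _).2 ⟨h, by simp⟩

open Relation in
theorem run_reach {N : ℕ} {F : Set (Sym2 (Fin (N+3)))} {i j : Fin (N+3)}
    (h : ReflTransGen (cycStep F) i j) : (SimpleGraph.fromEdgeSet F).Reachable i j := by
  induction h with
  | refl => exact .refl _
  | tail _ h ih => exact ih.trans (step_adj h).reachable

open Relation in
theorem run_loop {N : ℕ} {F : Set (Sym2 (Fin (N+3)))} {i : Fin (N+3)}
    (h : TransGen (cycStep F) i i) (x : Fin (N+3)) : s(x, x+1) ∈ F := by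
  have := cyc_ind (fun x => TransGen (cycStep F) x x) i h (by
    intro x hx
    obtain ⟨c, hc, hc'⟩ := TransGen.head'_iff.1 hx
    obtain rfl := hc.1
    exact TransGen.tail' hc' hc) x
  obtain ⟨c, hc, hc'⟩ := TransGen.head'_iff.1 this
  exact hc.2

theorem not_all_of_acyclic {N : ℕ} {F : Set (Sym2 (Fin (N+3)))}
    (hA : (SimpleGraph.fromEdgeSet F).IsAcyclic) : ¬ ∀ x, s(x, x+1) ∈ F := by
  intro h
  have hle : SimpleGraph.cycleGraph (N+3) ≤ SimpleGraph.fromEdgeSet F := by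
    intro u v huv
    refine (SimpleGraph.fromEdgeSet_adj _).2 ⟨?_, huv.ne⟩
    obtain ⟨i, hi⟩ := cyc_edge.1 ((SimpleGraph.mem_edgeSet _).2 huv)
    rw [hi]; exact h i
  exact (hA.anti hle) _ (SimpleGraph.cycleGraph.isCycle_cycle (n := N))

open Relation in
theorem acyclic_of_not_all {N : ℕ} {F : Set (Sym2 (Fin (N+3)))}
    (hF : F ⊆ (SimpleGraph.cycleGraph (N+3)).edgeSet)
    (h : ¬ ∀ x, s(x, x+1) ∈ F) : (SimpleGraph.fromEdgeSet F).IsAcyclic := by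
  rw [SimpleGraph.isAcyclic_iff_forall_isBridge]
  intro e he
  have heF : e ∈ F := by
    rw [SimpleGraph.edgeSet_fromEdgeSet] at he; exact he.1
  obtain ⟨a, rfl⟩ := cyc_edge.1 (hF heF)
  rw [SimpleGraph.isBridge_iff]
  intro hr
  have e1 : (SimpleGraph.fromEdgeSet F).deleteEdges {s(a, a+1)}
      = SimpleGraph.fromEdgeSet (F \ {s(a, a+1)}) := by
    ext u v; simp
  rw [e1] at hr
  rcases reach_run (Set.sdiff_subset.trans hF) hr with hr | hr
  · rcases ReflTransGen.cases_head hr with h1 | ⟨c, hc, -⟩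
    · simp at h1
    · exact hc.2.2 rfl
  · apply h
    have hback : ReflTransGen (cycStep F) (a+1) a :=
      ReflTransGen.mono (fun x y hxy => ⟨hxy.1, hxy.2.1⟩) _ _ hr
    exact run_loop (TransGen.head' ⟨rfl, heF⟩ hback)

/-- Valid pointer words: `0` is a root, `1` points forward, `2` points backward. -/
def validWord {N : ℕ} (w : Fin (N+3) → Fin 3) : Prop :=
  (∀ i, ¬ (w i = 1 ∧ w (i+1) = 2)) ∧ (¬ ∀ i, w i = 1) ∧ (¬ ∀ i, w i = 2)

def wordEdges {N : ℕ} (w : Fin (N+3) → Fin 3) : Set (Sym2 (Fin (N+3))) :=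
  {e | ∃ i, e = s(i, i+1) ∧ (w i = 1 ∨ w (i+1) = 2)}

theorem mem_wordEdges {N : ℕ} {w : Fin (N+3) → Fin 3} {a : Fin (N+3)} :
    s(a, a+1) ∈ wordEdges w ↔ w a = 1 ∨ w (a+1) = 2 := by
  constructor
  · rintro ⟨i, hi, h⟩
    obtain rfl := edge_eq.1 hi
    exact h
  · intro h; exact ⟨a, rfl, h⟩

theorem wordEdges_sub {N : ℕ} (w : Fin (N+3) → Fin 3) :
    wordEdges w ⊆ (SimpleGraph.cycleGraph (N+3)).edgeSet := by
  rintro e ⟨i, rfl, -⟩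
  exact cyc_edge.2 ⟨i, rfl⟩

theorem fin3 (x : Fin 3) : x = 0 ∨ x = 1 ∨ x = 2 := by
  revert x; decide


theorem wordEdges_not_all {N : ℕ} {w : Fin (N+3) → Fin 3} (hw : validWord w) :
    ¬ ∀ x, s(x, x+1) ∈ wordEdges w := by
  intro h
  simp only [mem_wordEdges] at h
  obtain ⟨h1, h2, h3⟩ := hw
  push Not at h2
  obtain ⟨i, hi⟩ := h2
  apply h3
  refine cyc_ind (fun x => w x = 2) (i+1) ((h i).resolve_left hi) ?_
  intro x hx
  refine (h x).resolve_left ?_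
  rw [hx]; decide

open Relation in
theorem exists_root {N : ℕ} {w : Fin (N+3) → Fin 3} (hw : validWord w) (i : Fin (N+3)) :
    ∃ r, w r = 0 ∧ (SimpleGraph.fromEdgeSet (wordEdges w)).Reachable i r := by
  obtain ⟨h1, h2, h3⟩ := hw
  by_contra! hno
  rcases fin3 (w i) with h | h | h
  · exact hno i h (.refl _)
  · apply h2
    intro x
    refine (cyc_ind (fun x => w x = 1 ∧
      (SimpleGraph.fromEdgeSet (wordEdges w)).Reachable i x) i ⟨h, .refl _⟩ ?_ x).1
    rintro x ⟨hx, hr⟩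
    have hr' : (SimpleGraph.fromEdgeSet (wordEdges w)).Reachable i (x+1) :=
      hr.trans (step_adj ⟨rfl, mem_wordEdges.2 (.inl hx)⟩).reachable
    rcases fin3 (w (x+1)) with h' | h' | h'
    · exact absurd hr' (hno _ h')
    · exact ⟨h', hr'⟩
    · exact absurd ⟨hx, h'⟩ (h1 x)
  · apply h3
    intro x
    refine (cyc_ind' (fun x => w x = 2 ∧
      (SimpleGraph.fromEdgeSet (wordEdges w)).Reachable i x) i ⟨h, .refl _⟩ ?_ x).1
    rintro x ⟨hx, hr⟩
    have hr' : (SimpleGraph.fromEdgeSet (wordEdges w)).Reachable i x :=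
      hr.trans (step_adj ⟨rfl, mem_wordEdges.2 (.inr hx)⟩).reachable.symm
    rcases fin3 (w x) with h' | h' | h'
    · exact absurd hr' (hno _ h')
    · exact absurd ⟨h', hx⟩ (h1 x)
    · exact ⟨h', hr'⟩

open Relation in
theorem unique_root {N : ℕ} {w : Fin (N+3) → Fin 3} {r r' : Fin (N+3)}
    (hr : w r = 0) (hr' : w r' = 0)
    (h : (SimpleGraph.fromEdgeSet (wordEdges w)).Reachable r r') : r = r' := by
  have aux : ∀ a b, w a = 0 → ReflTransGen (cycStep (wordEdges w)) a b → a = b ∨ w b = 2 := by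
    intro a b ha hab
    induction hab with
    | refl => left; rfl
    | tail _ hs ih =>
      right
      obtain ⟨rfl, hs⟩ := hs
      refine (mem_wordEdges.1 hs).resolve_left ?_
      rcases ih with rfl | ih
      · rw [ha]; decide
      · rw [ih]; decide
  rcases reach_run (wordEdges_sub w) h with h | h
  · refine (aux _ _ hr h).resolve_right ?_
    rw [hr']; decide
  · refine ((aux _ _ hr' h).resolve_right ?_).symm
    rw [hr]; decide

theorem word_ext {N : ℕ} {w v : Fin (N+3) → Fin 3} (hw : validWord w) (hv : validWord v)
    (hF : wordEdges w = wordEdges v) (h0 : ∀ i, w i = 0 ↔ v i = 0) : w = v := by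
  have hE : ∀ a, (w a = 1 ∨ w (a+1) = 2) ↔ (v a = 1 ∨ v (a+1) = 2) := by
    intro a; rw [← mem_wordEdges, ← mem_wordEdges, hF]
  have aux : ∀ {w v : Fin (N+3) → Fin 3}, validWord w → validWord v →
      (∀ a, (w a = 1 ∨ w (a+1) = 2) ↔ (v a = 1 ∨ v (a+1) = 2)) →
      (∀ i, w i = 0 ↔ v i = 0) → ∀ i, w i = 1 → v i = 2 → False := by
    intro w v hw hv hE h0 i h1 h2
    apply hw.2.1
    intro x
    refine (cyc_ind (fun x => w x = 1 ∧ v x = 2) i ⟨h1, h2⟩ ?_ x).1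
    rintro x ⟨hx, hx'⟩
    have hv2 : v (x+1) = 2 := by
      refine ((hE x).1 (.inl hx)).resolve_left ?_
      rw [hx']; decide
    refine ⟨?_, hv2⟩
    rcases fin3 (w (x+1)) with h' | h' | h'
    · rw [h0, hv2] at h'; exact absurd h' (by decide)
    · exact h'
    · exact absurd ⟨hx, h'⟩ (hw.1 x)
  funext i
  have hi := h0 i
  have a1 := aux hw hv hE h0 i
  have a2 := aux hv hw (fun a => (hE a).symm) (fun a => (h0 a).symm) i
  rcases fin3 (w i) with h | h | h <;> rcases fin3 (v i) with h' | h' | h' <;>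
    simp_all

open Relation in
theorem word_exists {N : ℕ} {F : Set (Sym2 (Fin (N+3)))}
    (hF : F ⊆ (SimpleGraph.cycleGraph (N+3)).edgeSet)
    (hA : (SimpleGraph.fromEdgeSet F).IsAcyclic)
    (R : Fin (N+3) → Prop)
    (hex : ∀ i, ∃ r, R r ∧ (SimpleGraph.fromEdgeSet F).Reachable i r)
    (huq : ∀ r r', R r → R r' → (SimpleGraph.fromEdgeSet F).Reachable r r' → r = r') :
    ∃ w : Fin (N+3) → Fin 3, validWord w ∧ wordEdges w = F ∧ ∀ i, w i = 0 ↔ R i := by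
  classical
  have hna := not_all_of_acyclic hA
  let Q : Fin (N+3) → Prop := fun i => ∃ r, R r ∧ ReflTransGen (cycStep F) i r
  let w : Fin (N+3) → Fin 3 := fun i => if R i then 0 else if Q i then 1 else 2
  have w0 : ∀ i, w i = 0 ↔ R i := by
    intro i; simp only [w]; split_ifs <;> simp_all
  have w1 : ∀ i, w i = 1 ↔ ¬ R i ∧ Q i := by
    intro i; simp only [w]; split_ifs <;> simp_all
  have w2 : ∀ i, w i = 2 ↔ ¬ R i ∧ ¬ Q i := by
    intro i; simp only [w]; split_ifs <;> simp_all
  have qstep : ∀ i, ¬ R i → Q i → s(i, i+1) ∈ F ∧ Q (i+1) := by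
    rintro i hi ⟨r, hr, hrun⟩
    rcases ReflTransGen.cases_head hrun with h | ⟨c, hc, hc'⟩
    · exact absurd (h ▸ hr) hi
    · obtain ⟨rfl, hc⟩ := hc
      exact ⟨hc, r, hr, hc'⟩
  obtain ⟨r0, hr0, -⟩ := hex 0
  have hr00 := (w0 r0).2 hr0
  refine ⟨w, ⟨?_, ?_, ?_⟩, ?_, w0⟩
  · rintro i ⟨h1, h2⟩
    rw [w1] at h1
    rw [w2] at h2
    exact h2.2 (qstep i h1.1 h1.2).2
  · intro h; rw [h r0] at hr00; exact absurd hr00 (by decide)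
  · intro h; rw [h r0] at hr00; exact absurd hr00 (by decide)
  · have main : ∀ i, s(i, i+1) ∈ wordEdges w ↔ s(i, i+1) ∈ F := by
      intro i
      rw [mem_wordEdges, w1, w2]
      constructor
      · rintro (⟨h1, h2⟩ | ⟨h1, h2⟩)
        · exact (qstep i h1 h2).1
        · obtain ⟨r, hr, hre⟩ := hex (i+1)
          rcases reach_run hF hre with h | h
          · exact absurd ⟨r, hr, h⟩ h2
          · rcases ReflTransGen.cases_tail h with h | ⟨c, hc, hc'⟩
            · exact absurd (h ▸ hr) h1
            · have : i = c := add_right_cancel hc'.1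
              rw [this]; exact hc'.2
      · intro hi
        have st : cycStep F i (i+1) := ⟨rfl, hi⟩
        by_cases hQ : Q (i+1)
        · left
          obtain ⟨r, hr, hrun⟩ := hQ
          have hrun' := ReflTransGen.head st hrun
          refine ⟨fun hRi => ?_, r, hr, hrun'⟩
          have := huq _ _ hRi hr (run_reach hrun')
          subst this
          exact hna (run_loop (TransGen.head' st hrun))
        · right
          exact ⟨fun h => hQ ⟨_, h, .refl⟩, hQ⟩
    ext e
    constructor
    · intro he
      obtain ⟨i, rfl⟩ := cyc_edge.1 (wordEdges_sub w he)
      exact (main i).1 he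
    · intro he
      obtain ⟨i, rfl⟩ := cyc_edge.1 (hF he)
      exact (main i).2 he

open SimpleGraph in
theorem forest_card {N : ℕ} : rootedSpanningForestCard (SimpleGraph.cycleGraph (N+3)) =
    Nat.card {w : Fin (N+3) → Fin 3 // validWord w} := by
  symm
  unfold rootedSpanningForestCard
  have hc : ∀ w : {w : Fin (N+3) → Fin 3 // validWord w},
      ∀ c : (fromEdgeSet (wordEdges w.1)).ConnectedComponent,
      ∃ r, w.1 r = 0 ∧ (fromEdgeSet (wordEdges w.1)).connectedComponentMk r = c := by
    intro w c
    induction c using SimpleGraph.ConnectedComponent.ind with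
    | _ v =>
      obtain ⟨r, hr, h⟩ := exists_root w.2 v
      exact ⟨r, hr, ConnectedComponent.eq.2 h.symm⟩
  choose f hf0 hfc using hc
  have hroot : ∀ w i, w.1 i = 0 ↔ f w (connectedComponentMk _ i) = i := by
    intro w i
    constructor
    · intro h
      exact unique_root (hf0 w _) h (ConnectedComponent.eq.1 (hfc w _))
    · intro h
      rw [← h]; exact hf0 w _
  refine Nat.card_congr (Equiv.ofBijective (fun w => ⟨⟨wordEdges w.1, wordEdges_sub _,
    acyclic_of_not_all (wordEdges_sub _) (wordEdges_not_all w.2)⟩, ⟨f w, hfc w⟩⟩) ⟨?_, ?_⟩)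
  · intro w v h
    have hE : wordEdges w.1 = wordEdges v.1 := congrArg (fun z => z.1.1) h
    have hR : ∀ i, f w (connectedComponentMk _ i) = f v (connectedComponentMk _ i) := by
      intro i
      exact congrArg (fun z => z.2.1 (connectedComponentMk _ i)) h
    apply Subtype.ext
    refine word_ext w.2 v.2 hE ?_
    intro i
    rw [hroot, hroot, hR]
  · rintro ⟨⟨F, hF, hA⟩, ⟨g, hg⟩⟩
    obtain ⟨w, hw, rfl, h0⟩ := word_exists hF hA
      (fun i => g (connectedComponentMk _ i) = i)
      (fun i => ⟨g (connectedComponentMk _ i), by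
        show g (connectedComponentMk _ _) = _
        rw [hg], (ConnectedComponent.eq.1 (hg _)).symm⟩)
      (fun r r' hr hr' h => by
        rw [← hr, ← hr', ConnectedComponent.eq.2 h])
    refine ⟨⟨w, hw⟩, ?_⟩
    have : f ⟨w, hw⟩ = g := by
      funext c
      have := (h0 _).1 (hf0 ⟨w, hw⟩ c)
      rw [hfc ⟨w, hw⟩ c] at this
      exact this.symm
    simp only [this]

/-- Transfer matrix. -/
def transM : Matrix (Fin 3) (Fin 3) ℤ := !![1,1,1;1,1,0;1,1,1]

theorem transM_apply (a b : Fin 3) : transM a b = if (a = 1 ∧ b = 2) then 0 else 1 := by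
  fin_cases a <;> fin_cases b <;> simp [transM]

theorem path_sum (k : ℕ) (a b : Fin 3) :
    ∑ w : Fin k → Fin 3, ∏ i : Fin (k+1),
      transM ((Fin.cons a w : Fin (k+1) → Fin 3) i) ((Fin.snoc w b : Fin (k+1) → Fin 3) i)
      = (transM ^ (k+1)) a b := by
  induction k generalizing a with
  | zero => simp; rfl
  | succ k ih =>
    rw [pow_succ', Matrix.mul_apply]
    rw [← (Fin.consEquiv (fun _ => Fin 3)).sum_comp, Fintype.sum_prod_type]
    refine Finset.sum_congr rfl fun c _ => ?_
    rw [← ih, Finset.mul_sum]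
    refine Finset.sum_congr rfl fun w _ => ?_
    rw [Fin.prod_univ_succ]
    simp only [Fin.consEquiv, Equiv.coe_fn_mk, ← Fin.cons_snoc_eq_snoc_cons, Fin.cons_zero,
      Fin.cons_succ]

theorem trace_sum (N : ℕ) : ∑ w : Fin (N+3) → Fin 3, ∏ i, transM (w i) (w (i+1))
      = (transM ^ (N+3)).trace := by
  rw [← (Fin.consEquiv (fun _ => Fin 3)).sum_comp, Fintype.sum_prod_type, Matrix.trace]
  refine Finset.sum_congr rfl fun c _ => ?_
  rw [Matrix.diag_apply, ← path_sum]
  refine Finset.sum_congr rfl fun w _ => ?_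
  refine Finset.prod_congr rfl fun i _ => ?_
  simp only [Fin.consEquiv, Equiv.coe_fn_mk]
  congr 1
  induction i using Fin.lastCases with
  | last => simp
  | cast j => rw [Fin.coeSucc_eq_succ]; simp

theorem trace_fib (k : ℕ) : (transM ^ (k+1)).trace = Nat.fib (2*k+1) + Nat.fib (2*k+3) := by
  have h3 : transM ^ 3 = 3 • transM ^ 2 - transM := by
    simp only [pow_succ, pow_zero, one_mul]; decide
  induction k using Nat.twoStepInduction with
  | zero => simp [Matrix.trace_fin_three, transM, Nat.fib]
  | one => simp only [pow_succ, pow_zero, one_mul]; decide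
  | more k h1 h2 =>
    have : transM ^ (k+2+1) = 3 • transM ^ (k+1+1) - transM ^ (k+1) := by
      rw [show k+2+1 = k + 3 by ring, pow_add, h3, mul_sub, mul_smul_comm, ← pow_add, ← pow_succ]
    rw [this, Matrix.trace_sub, Matrix.trace_smul, h1, h2]
    have e : ∀ j, Nat.fib (j+2) = Nat.fib j + Nat.fib (j+1) := fun j => Nat.fib_add_two
    have a1 := e (2*k+1)
    have a2 := e (2*k+2)
    have a3 := e (2*k+3)
    have a4 := e (2*k+4)
    have a5 := e (2*k+5)
    simp only [show 2*(k+1)+1 = 2*k+3 by ring, show 2*(k+1)+3 = 2*k+5 by ring,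
      show 2*(k+2)+1 = 2*k+5 by ring, show 2*(k+2)+3 = 2*k+7 by ring]
    simp only [add_assoc, Nat.reduceAdd] at a1 a2 a3 a4 a5
    simp only [nsmul_eq_mul]
    push_cast
    omega

open Classical in
theorem valid_card (N : ℕ) : Nat.card {w : Fin (N+3) → Fin 3 // validWord w} + 2 =
    Nat.fib (2*N+5) + Nat.fib (2*N+7) := by
  have hc : ((Finset.univ.filter (fun w : Fin (N+3) → Fin 3 =>
      ∀ i, ¬ (w i = 1 ∧ w (i+1) = 2))).card : ℤ) = Nat.fib (2*N+5) + Nat.fib (2*N+7) := by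
    have := trace_fib (N+2)
    rw [show 2*(N+2)+1 = 2*N+5 by ring, show 2*(N+2)+3 = 2*N+7 by ring] at this
    rw [← this, ← trace_sum, Finset.card_filter]
    push_cast
    refine Finset.sum_congr rfl fun w _ => ?_
    simp only [transM_apply]
    split_ifs with h
    · symm
      apply Finset.prod_eq_one
      intro i _
      rw [if_neg (h i)]
    · push Not at h
      obtain ⟨i, hi⟩ := h
      symm
      apply Finset.prod_eq_zero (Finset.mem_univ i)
      rw [if_pos hi]
  have hs : Finset.univ.filter (fun w : Fin (N+3) → Fin 3 => ∀ i, ¬ (w i = 1 ∧ w (i+1) = 2)) =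
      insert (fun _ => 1) (insert (fun _ => 2) (Finset.univ.filter
        (fun w : Fin (N+3) → Fin 3 => validWord w))) := by
    ext w
    simp only [Finset.mem_filter, Finset.mem_univ, true_and, Finset.mem_insert]
    unfold validWord
    constructor
    · intro h
      by_cases h1 : ∀ i, w i = 1
      · left; funext i; exact h1 i
      by_cases h2 : ∀ i, w i = 2
      · right; left; funext i; exact h2 i
      exact .inr (.inr ⟨h, h1, h2⟩)
    · rintro (rfl | rfl | h)
      · simp
      · simp
      · exact h.1
  rw [hs, Finset.card_insert_of_notMem, Finset.card_insert_of_notMem] at hc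
  · rw [Nat.card_eq_fintype_card, Fintype.card_subtype]
    push_cast at hc
    omega
  · simp [validWord]
  · simp only [Finset.mem_insert, not_or]
    refine ⟨fun h => absurd (congrFun h 0) (by decide), ?_⟩
    simp [validWord]

/-- The cycle graph on `2n+1` vertices has
`Φ_{4n+1} + Φ_{4n+3} - 2` rooted spanning forests. -/
theorem stmt7 (n : ℕ) (hn : 1 ≤ n) :
    rootedSpanningForestCard (SimpleGraph.cycleGraph (2 * n + 1)) =
      Nat.fib (4 * n + 1) + Nat.fib (4 * n + 3) - 2 := by
  obtain ⟨k, rfl⟩ : ∃ k, n = k + 1 := ⟨n - 1, by omega⟩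
  have h := valid_card (2*k)
  have h' := forest_card (N := 2*k)
  rw [show 4 * (k+1) + 1 = 2*(2*k)+5 by ring, show 4 * (k+1) + 3 = 2*(2*k)+7 by ring]
  change rootedSpanningForestCard (SimpleGraph.cycleGraph (2 * k + 3)) = _
  omega
end
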